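/- Let U be a domain in ℝ^m and let l : ℝ → [0,+∞] be a function which is finite at at least one point. Then the family E of all harmonic functions f on U satisfying |∇f(x)| ≤ l(f(x)) for every x ∈ U is a normal family. -/

import Mathlib

open Filter Topology Metric

noncomputable section

/-- `ℝ^m` with the Euclidean structure. -/
abbrev E (m : ℕ) := EuclideanSpace ℝ (Fin m)

/-- The Laplacian of `f` at `x`. -/
noncomputable def lap {m : ℕ} (f : E m → ℝ) (x : E m) : ℝ :=
  ∑ i, fderiv ℝ (fun y => fderiv ℝ f y (EuclideanSpace.single i 1)) x (EuclideanSpace.single i 1)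

/-- `f` is harmonic on `U`: real-valued, `C²` with vanishing Laplacian. -/
def HarmOn {m : ℕ} (U : Set (E m)) (f : E m → ℝ) : Prop :=
  ContDiffOn ℝ 2 f U ∧ ∀ x ∈ U, lap f x = 0

/-- `f̃ x = |∇f(x)| / cosh (f x)`. -/
noncomputable def tilde {m : ℕ} (f : E m → ℝ) (x : E m) : ℝ :=
  ‖gradient f x‖ / Real.cosh (f x)

/-- `S(x) = arctan (sinh x)`, extended to `[-∞,+∞]` by `S(±∞) = ±π/2`.  The distance on
`[-∞,+∞]` is `d(x,y) = |S x - S y|`. -/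
noncomputable def SF : EReal → ℝ := fun x =>
  if x = ⊤ then Real.pi / 2 else if x = ⊥ then -(Real.pi / 2)
  else Real.arctan (Real.sinh x.toReal)

/-- Uniform convergence on every compact subset of `U`, with respect to the distance
`d(x,y) = |S x - S y|` on `[-∞,+∞]`. -/
def TendstoCptsE {m : ℕ} (U : Set (E m)) (g : ℕ → E m → EReal) (G : E m → EReal) : Prop :=
  ∀ K ⊆ U, IsCompact K → ∀ ε > 0, ∃ N : ℕ, ∀ n ≥ N, ∀ x ∈ K, |SF (g n x) - SF (G x)| < ε

/-- A family `Fam` of harmonic functions on `U` is normal if every sequence in `Fam` has a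
subsequence converging uniformly on compact subsets of `U` either to a harmonic function on
`U`, or to the constant `+∞`, or to the constant `-∞`. -/
def NormalFam {m : ℕ} (U : Set (E m)) (Fam : Set (E m → ℝ)) : Prop :=
  ∀ f : ℕ → E m → ℝ, (∀ n, f n ∈ Fam) →
    ∃ φ : ℕ → ℕ, StrictMono φ ∧
      ((∃ g : E m → ℝ, HarmOn U g ∧
          TendstoCptsE U (fun k x => ((f (φ k) x : ℝ) : EReal)) (fun x => ((g x : ℝ) : EReal)))
       ∨ TendstoCptsE U (fun k x => ((f (φ k) x : ℝ) : EReal)) (fun _ => (⊤ : EReal))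
       ∨ TendstoCptsE U (fun k x => ((f (φ k) x : ℝ) : EReal)) (fun _ => (⊥ : EReal)))


open Filter Topology Metric MeasureTheory
noncomputable section

/-- radial kernel -/
def kr {m : ℕ} (y : E m) : ℝ := Real.smoothTransition (2 - 2 * ‖y‖ ^ 2)

/-- potential of the radial kernel -/
def kp {m : ℕ} (y : E m) : ℝ :=
  (1 / 2) * ∫ s in (1 : ℝ)..(‖y‖ ^ 2), Real.smoothTransition (2 - 2 * s)

lemma kr_contDiff {m : ℕ} {n : ℕ∞} : ContDiff ℝ n (kr : E m → ℝ) := by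
  unfold kr
  exact Real.smoothTransition.contDiff.comp (contDiff_const.sub (contDiff_const.mul (contDiff_norm_sq ℝ)))

lemma kr_nonneg {m : ℕ} (y : E m) : 0 ≤ kr y := Real.smoothTransition.nonneg _
lemma kr_le_one {m : ℕ} (y : E m) : kr y ≤ 1 := Real.smoothTransition.le_one _

lemma kr_zero {m : ℕ} {y : E m} (h : 1 ≤ ‖y‖) : kr y = 0 := by
  apply Real.smoothTransition.zero_of_nonpos
  nlinarith

lemma kr_one {m : ℕ} {y : E m} (h : ‖y‖ ^ 2 ≤ 1 / 2) : kr y = 1 := by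
  apply Real.smoothTransition.one_of_one_le
  linarith

lemma kr_compact {m : ℕ} : HasCompactSupport (kr : E m → ℝ) := by
  apply HasCompactSupport.intro (isCompact_closedBall (0 : E m) 1)
  intro x hx
  apply kr_zero
  simp at hx
  exact hx.le

lemma kr_int_pos {m : ℕ} : 0 < ∫ y : E m, kr y := by
  apply Continuous.integral_pos_of_hasCompactSupport_nonneg_nonzero
    (kr_contDiff (n := 0)).continuous kr_compact kr_nonneg (x := 0)
  rw [kr_one (by simp)]
  exact one_ne_zero

lemma kp_zero {m : ℕ} {y : E m} (h : 1 ≤ ‖y‖) : kp y = 0 := by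
  unfold kp
  have h1 : (1 : ℝ) ≤ ‖y‖ ^ 2 := by nlinarith
  rw [intervalIntegral.integral_congr (g := fun _ => 0)]
  · simp
  · intro s hs
    rw [Set.uIcc_of_le h1] at hs
    apply Real.smoothTransition.zero_of_nonpos
    linarith [hs.1]

lemma kp_compact {m : ℕ} : HasCompactSupport (kp : E m → ℝ) := by
  apply HasCompactSupport.intro (isCompact_closedBall (0 : E m) 1)
  intro x hx
  apply kp_zero
  simp at hx
  exact hx.le

lemma kp_hasFDerivAt {m : ℕ} (y : E m) : HasFDerivAt kp (kr y • innerSL ℝ y) y := by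
  have hc : Continuous fun s : ℝ => Real.smoothTransition (2 - 2 * s) :=
    Real.smoothTransition.continuous.comp (by fun_prop)
  have h1 : HasDerivAt (fun u : ℝ => ∫ s in (1 : ℝ)..u, Real.smoothTransition (2 - 2 * s))
      (kr y) (‖y‖ ^ 2) :=
    intervalIntegral.integral_hasDerivAt_right (hc.intervalIntegrable _ _)
      (hc.stronglyMeasurableAtFilter _ _) hc.continuousAt
  have h2 := (h1.comp_hasFDerivAt y (hasStrictFDerivAt_norm_sq y).hasFDerivAt).const_mul (1 / 2 : ℝ)
  refine h2.congr_fderiv ?_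
  ext v
  simp
  ring

lemma kp_diff {m : ℕ} : Differentiable ℝ (kp : E m → ℝ) :=
  fun y => (kp_hasFDerivAt y).differentiableAt

lemma kp_fderiv {m : ℕ} (y : E m) (i : Fin m) :
    fderiv ℝ kp y (EuclideanSpace.single i 1) = kr y * y i := by
  rw [(kp_hasFDerivAt y).fderiv]
  simp [EuclideanSpace.inner_single_right]

end

open Filter Topology Metric MeasureTheory
noncomputable section

lemma lap_congr {m : ℕ} {f g : E m → ℝ} {x : E m} (h : f =ᶠ[𝓝 x] g) : lap f x = lap g x := by
  unfold lap
  refine Finset.sum_congr rfl fun i _ => ?_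
  have h1 : (fun y => fderiv ℝ f y (EuclideanSpace.single i 1)) =ᶠ[𝓝 x]
      (fun y => fderiv ℝ g y (EuclideanSpace.single i 1)) := by
    filter_upwards [h.fderiv (𝕜 := ℝ)] with y hy
    rw [hy]
  rw [h1.fderiv_eq]

lemma clm_sum {m : ℕ} (T : E m →L[ℝ] ℝ) (y : E m) :
    T y = ∑ i, y i * T (EuclideanSpace.single i 1) := by
  conv_lhs => rw [← (EuclideanSpace.basisFun (Fin m) ℝ).sum_repr y]
  simp [map_sum]

lemma int_zero {m : ℕ} {h : E m → ℝ} (hh : ContDiff ℝ 2 h) (w : E m) {r t : ℝ}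
    (ht0 : 0 ≤ t) (htr : t ≤ r) (hl : ∀ u ∈ closedBall w r, lap h u = 0) :
    ∫ y, fderiv ℝ h (w + t • y) y * kr y = 0 := by
  have hd : ContDiff ℝ 1 (fderiv ℝ h) := hh.fderiv_right (by norm_num)
  set a : Fin m → E m → ℝ := fun i y => fderiv ℝ h (w + t • y) (EuclideanSpace.single i 1) with ha
  set b : Fin m → E m → ℝ := fun i z => fderiv ℝ h z (EuclideanSpace.single i 1) with hb
  have hbC : ∀ i, ContDiff ℝ 1 (b i) := fun i => hd.clm_apply contDiff_const
  have hab : ∀ i y, HasFDerivAt (a i) (t • fderiv ℝ (b i) (w + t • y)) y := by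
    intro i y
    have h1 : HasFDerivAt (fun y : E m => w + t • y) (t • ContinuousLinearMap.id ℝ (E m)) y :=
      ((hasFDerivAt_id y).const_smul t).const_add w
    have h2 := (((hbC i).differentiable one_ne_zero) (w + t • y)).hasFDerivAt.comp y h1
    refine h2.congr_fderiv ?_
    ext v
    simp
  have haC : ∀ i, Continuous (a i) := fun i =>
    (hbC i).continuous.comp (by fun_prop)
  have hfk : ∀ i : Fin m, (fun y : E m => fderiv ℝ kp y (EuclideanSpace.single i 1)) =
      fun y => kr y * y i := fun i => funext fun y => kp_fderiv y i
  have hkC : Continuous (kr : E m → ℝ) := (kr_contDiff (n := 0)).continuous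
  have hpC : Continuous (kp : E m → ℝ) := kp_diff.continuous
  have hbfC : ∀ i, Continuous (fun y => fderiv ℝ (a i) y (EuclideanSpace.single i 1)) := by
    intro i
    have : (fun y => fderiv ℝ (a i) y (EuclideanSpace.single i 1)) =
      fun y => t * fderiv ℝ (b i) (w + t • y) (EuclideanSpace.single i 1) := by
      funext y
      rw [(hab i y).fderiv]; simp
    rw [this]
    have h3 : Continuous (fderiv ℝ (b i)) := (hbC i).continuous_fderiv one_ne_zero
    fun_prop
  have hIg1 : ∀ i, Integrable (fun y => a i y * fderiv ℝ kp y (EuclideanSpace.single i 1)) := by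
    intro i
    simp_rw [kp_fderiv]
    apply Continuous.integrable_of_hasCompactSupport
    · have := haC i
      fun_prop
    · exact (kr_compact.mul_right).mul_left
  have e1 : (fun y => fderiv ℝ h (w + t • y) y * kr y) =
      fun y => ∑ i, a i y * fderiv ℝ kp y (EuclideanSpace.single i 1) := by
    funext y
    rw [clm_sum (fderiv ℝ h (w + t • y)) y, Finset.sum_mul]
    refine Finset.sum_congr rfl fun i _ => ?_
    rw [kp_fderiv]
    ring
  have hIg2 : ∀ i, Integrable
      (fun y => fderiv ℝ (a i) y (EuclideanSpace.single i 1) * kp y) := by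
    intro i
    apply Continuous.integrable_of_hasCompactSupport
    · exact (hbfC i).mul hpC
    · exact kp_compact.mul_left
  rw [e1, integral_finsetSum _ fun i _ => hIg1 i]
  have e2 : ∀ i, ∫ y, a i y * fderiv ℝ kp y (EuclideanSpace.single i 1) =
      - ∫ y, fderiv ℝ (a i) y (EuclideanSpace.single i 1) * kp y := by
    intro i
    apply integral_mul_fderiv_eq_neg_fderiv_mul_of_integrable (hIg2 i) (hIg1 i)
    · apply Continuous.integrable_of_hasCompactSupport
      · exact (haC i).mul hpC
      · exact kp_compact.mul_left
    · exact fun y _ => (hab i y).differentiableAt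
    · exact fun y _ => kp_diff y
  simp_rw [e2]
  rw [Finset.sum_neg_distrib, ← integral_finsetSum _ fun i _ => hIg2 i, neg_eq_zero]
  apply integral_eq_zero_of_ae
  refine Eventually.of_forall fun y => ?_
  simp only [Pi.zero_apply]
  rw [← Finset.sum_mul]
  by_cases hy : 1 ≤ ‖y‖
  · rw [kp_zero hy, mul_zero]
  · have hy' : w + t • y ∈ closedBall w r := by
      simp only [mem_closedBall, dist_self_add_left, norm_smul, Real.norm_eq_abs, abs_of_nonneg ht0]
      nlinarith [norm_nonneg y]
    have h4 := hl _ hy'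
    have : ∑ i, fderiv ℝ (a i) y (EuclideanSpace.single i 1) = t * lap h (w + t • y) := by
      unfold lap
      rw [Finset.mul_sum]
      refine Finset.sum_congr rfl fun i _ => ?_
      rw [(hab i y).fderiv]; simp [hb]
    rw [this, h4]; simp

lemma mv_global {m : ℕ} {h : E m → ℝ} (hh : ContDiff ℝ 2 h) (hc : HasCompactSupport h)
    (w : E m) {r : ℝ} (hr : 0 ≤ r) (hl : ∀ u ∈ closedBall w r, lap h u = 0) :
    ∫ y, h (w + r • y) * kr y = h w * ∫ y : E m, kr y := by
  have hkC : Continuous (kr : E m → ℝ) := (kr_contDiff (n := 0)).continuous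
  have hfC : Continuous (fderiv ℝ h) := hh.continuous_fderiv two_ne_zero
  obtain ⟨C, hC⟩ := (hc.fderiv ℝ).exists_bound_of_continuous hfC
  have hder : ∀ t, HasDerivAt (fun t : ℝ => ∫ y, h (w + t • y) * kr y)
      (∫ y, fderiv ℝ h (w + t • y) y * kr y) t := by
    intro t
    refine (hasDerivAt_integral_of_dominated_loc_of_deriv_le
      (F := fun t y => h (w + t • y) * kr y)
      (F' := fun t y => fderiv ℝ h (w + t • y) y * kr y)
      (bound := fun y => C * ‖y‖ * kr y) (s := Set.univ) univ_mem ?_ ?_ ?_ ?_ ?_ ?_).2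
    · refine Eventually.of_forall fun s => Continuous.aestronglyMeasurable ?_
      have := hh.continuous
      fun_prop
    · apply Continuous.integrable_of_hasCompactSupport
      · have := hh.continuous
        fun_prop
      · exact kr_compact.mul_left
    · apply Continuous.aestronglyMeasurable
      fun_prop
    · refine Eventually.of_forall fun y s _ => ?_
      rw [norm_mul, Real.norm_of_nonneg (kr_nonneg y)]
      gcongr
      · exact kr_nonneg y
      · exact (ContinuousLinearMap.le_opNorm _ _).trans
          (mul_le_mul_of_nonneg_right (hC _) (norm_nonneg _))
    · apply Continuous.integrable_of_hasCompactSupport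
      · fun_prop
      · exact kr_compact.mul_left
    · refine Eventually.of_forall fun y s _ => ?_
      have h1 : HasDerivAt (fun s : ℝ => w + s • y) y s := by
        simpa using ((hasDerivAt_id s).smul_const y).const_add w
      exact (((hh.differentiable two_ne_zero) _).hasFDerivAt.comp_hasDerivAt s h1).mul_const _
  have key := constant_of_has_deriv_right_zero (f := fun t : ℝ => ∫ y, h (w + t • y) * kr y)
    (a := 0) (b := r) (fun t _ => (hder t).continuousAt.continuousWithinAt) (by
      intro t ht
      have := (hder t).hasDerivWithinAt (s := Set.Ici t)
      rwa [int_zero hh w ht.1 ht.2.le hl] at this) r ⟨hr, le_rfl⟩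
  simp only [zero_smul, add_zero] at key
  rw [key, integral_const_mul]

/-- mean value property -/
lemma mv {m : ℕ} {U : Set (E m)} {h : E m → ℝ} (hh : HarmOn U h) (hU : IsOpen U)
    (w : E m) {r R : ℝ} (hr : 0 < r) (hrR : r < R) (hB : closedBall w R ⊆ U) :
    ∫ u, h u * kr (r⁻¹ • (w - u)) = h w * (r ^ m * ∫ y : E m, kr y) := by
  obtain ⟨R', h1, h2⟩ := exists_between hrR
  let χ : ContDiffBump w := ⟨R', R, hr.trans h1, h2⟩
  set H : E m → ℝ := fun u => χ u * h u with hH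
  have hHc : HasCompactSupport H := χ.hasCompactSupport.mul_right
  have hHC : ContDiff ℝ 2 H := by
    rw [contDiff_iff_contDiffAt]
    intro x
    by_cases hx : x ∈ tsupport χ
    · have hxU : x ∈ U := by
        rw [χ.tsupport_eq] at hx
        exact hB hx
      exact χ.contDiff.contDiffAt.mul (hh.1.contDiffAt (hU.mem_nhds hxU))
    · have : H =ᶠ[𝓝 x] fun _ => 0 := by
        filter_upwards [(isClosed_tsupport χ).isOpen_compl.mem_nhds hx] with y hy
        simp only [hH]
        rw [image_eq_zero_of_notMem_tsupport hy, zero_mul]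
      exact contDiffAt_const.congr_of_eventuallyEq this
  have heq : ∀ x ∈ ball w R', H x = h x := by
    intro x hx
    simp only [hH]
    rw [χ.one_of_mem_closedBall (ball_subset_closedBall hx), one_mul]
  have hlap : ∀ u ∈ closedBall w r, lap H u = 0 := by
    intro u hu
    have hu' : u ∈ ball w R' := closedBall_subset_ball h1 hu
    rw [lap_congr (g := h)]
    · exact hh.2 u (hB (closedBall_subset_closedBall hrR.le hu))
    · filter_upwards [isOpen_ball.mem_nhds hu'] with y hy using heq y hy
  have key := mv_global hHC hHc w hr.le hlap
  have hw : H w = h w := heq w (mem_ball_self (hr.trans h1))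
  have e0 : ∀ u, h u * kr (r⁻¹ • (w - u)) = H u * kr (r⁻¹ • (w - u)) := by
    intro u
    by_cases hu : u ∈ ball w R'
    · rw [heq u hu]
    · rw [kr_zero, mul_zero, mul_zero]
      rw [norm_smul, norm_inv, Real.norm_of_nonneg hr.le, ← dist_eq_norm, dist_comm]
      simp only [mem_ball, not_lt] at hu
      rw [inv_mul_eq_div, le_div_iff₀ hr]
      linarith
  simp_rw [e0]
  have e1 : ∫ u, H u * kr (r⁻¹ • (w - u)) = ∫ v, H (w + v) * kr (r⁻¹ • v) := by
    rw [← integral_add_left_eq_self _ w]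
    congr 1
    funext v
    have : kr (r⁻¹ • (w - (w + v))) = kr (r⁻¹ • v) := by
      unfold kr
      simp [norm_smul]
    rw [this]
  have e2 := Measure.integral_comp_smul (volume : Measure (E m))
    (fun v => H (w + v) * kr (r⁻¹ • v)) r
  simp only [smul_smul, inv_mul_cancel₀ hr.ne', one_smul, finrank_euclideanSpace_fin] at e2
  rw [key, hw] at e2
  rw [e1, mul_left_comm, e2, smul_eq_mul, abs_of_pos (by positivity), ← mul_assoc,
    mul_inv_cancel₀ (by positivity), one_mul]

end

open Filter Topology Metric MeasureTheory
noncomputable section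

lemma kr_zero' {m : ℕ} {r : ℝ} (hr : 0 < r) {w u : E m} (h : r ≤ dist u w) :
    kr (r⁻¹ • (w - u)) = 0 := by
  apply kr_zero
  rw [norm_smul, norm_inv, Real.norm_of_nonneg hr.le, ← dist_eq_norm, dist_comm,
    inv_mul_eq_div, le_div_iff₀ hr]
  linarith

lemma integ {m : ℕ} {h : E m → ℝ} {w : E m} {r : ℝ} (hr : 0 < r)
    (hc : ContinuousOn h (closedBall w r)) :
    Integrable fun u => h u * kr (r⁻¹ • (w - u)) := by
  have hkC : Continuous (kr : E m → ℝ) := (kr_contDiff (n := 0)).continuous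
  have h1 : IntegrableOn (fun u => h u * kr (r⁻¹ • (w - u))) (closedBall w r) := by
    apply ContinuousOn.integrableOn_compact (isCompact_closedBall w r)
    exact hc.mul (by fun_prop)
  rwa [integrableOn_iff_integrable_of_support_subset] at h1
  intro u hu
  by_contra hn
  apply hu
  simp only [mem_closedBall, not_le] at hn
  simp only
  rw [kr_zero' hr hn.le, mul_zero]

lemma harnack {m : ℕ} {U : Set (E m)} {h : E m → ℝ} (hh : HarmOn U h) (hU : IsOpen U)
    {z w : E m} {R R' : ℝ} (hR : 0 < R) (hRR : 2 * R < R') (hB : closedBall z R' ⊆ U)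
    (hpos : ∀ u ∈ ball z (2 * R), 0 ≤ h u) (hd : dist w z ≤ R / 4) :
    h w ≤ 2 ^ m * h z := by
  have hBw : closedBall w (3 * R / 2) ⊆ U := by
    exact (closedBall_subset_closedBall' (by linarith)).trans hB
  have m1 := mv hh hU w hR (by linarith : R < 3 * R / 2) hBw
  have m2 := mv hh hU z (by linarith : 0 < 2 * R) hRR hB
  have hI := kr_int_pos (m := m)
  have hle : ∫ u, h u * kr (R⁻¹ • (w - u)) ≤ ∫ u, h u * kr ((2 * R)⁻¹ • (z - u)) := by
    apply integral_mono_of_nonneg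
    · refine Eventually.of_forall fun u => ?_
      by_cases hu : R ≤ dist u w
      · simp [kr_zero' hR hu]
      · apply mul_nonneg _ (kr_nonneg _)
        apply hpos
        simp only [mem_ball]
        linarith [dist_triangle u w z]
    · apply integ (by linarith)
      exact hh.1.continuousOn.mono ((closedBall_subset_closedBall hRR.le).trans hB)
    · refine Eventually.of_forall fun u => ?_
      simp only
      by_cases hu : R ≤ dist u w
      · simp only [kr_zero' hR hu, mul_zero]
        by_cases hu2 : 2 * R ≤ dist u z
        · rw [kr_zero' (by linarith) hu2, mul_zero]
        · exact mul_nonneg (hpos u (by simpa using hu2)) (kr_nonneg _)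
      · have hdz : dist u z ≤ 5 / 4 * R := by linarith [dist_triangle u w z]
        have : kr ((2 * R)⁻¹ • (z - u)) = 1 := by
          apply kr_one
          rw [norm_smul, norm_inv, Real.norm_of_nonneg (by linarith), ← dist_eq_norm, dist_comm,
            inv_mul_eq_div]
          have : dist u z / (2 * R) ≤ 5 / 8 := by
            rw [div_le_iff₀ (by linarith)]; linarith
          have h0 : 0 ≤ dist u z / (2 * R) := by positivity
          nlinarith
        rw [this]
        exact mul_le_mul_of_nonneg_left (kr_le_one _)
          (hpos u (by simp only [mem_ball]; linarith))
  rw [m1, m2, mul_pow] at hle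
  have hp : 0 < R ^ m * ∫ y : E m, kr y := by positivity
  have : h w * (R ^ m * ∫ y : E m, kr y) ≤ (2 ^ m * h z) * (R ^ m * ∫ y : E m, kr y) := by
    linarith
  exact le_of_mul_le_mul_right this hp

lemma second_deriv_nonneg {φ : ℝ → ℝ} (hmin : IsLocalMin φ 0) (hc : ContinuousAt φ 0) :
    0 ≤ deriv (deriv φ) 0 := by
  by_contra hn
  push Not at hn
  have hmax := isLocalMax_of_deriv_deriv_neg hn hmin.deriv_eq_zero hc
  have he : φ =ᶠ[𝓝 0] fun _ => φ 0 := by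
    filter_upwards [hmin, hmax] with t h1 h2 using le_antisymm h2 h1
  have h2 := he.deriv.deriv_eq
  simp at h2
  linarith

lemma locmin_lap {m : ℕ} {h : E m → ℝ} {x : E m} (hh : ContDiffAt ℝ 2 h x)
    (hmin : IsLocalMin h x) : 0 ≤ lap h x := by
  unfold lap
  refine Finset.sum_nonneg fun i _ => ?_
  set e : E m := EuclideanSpace.single i 1
  have hline : Continuous (fun t : ℝ => x + t • e) := by fun_prop
  have hl0 : x + (0 : ℝ) • e = x := by simp
  have htend : Tendsto (fun t : ℝ => x + t • e) (𝓝 0) (𝓝 x) := by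
    have := hline.tendsto 0
    rwa [hl0] at this
  have hline' : ∀ t, HasDerivAt (fun t : ℝ => x + t • e) e t := fun t => by
    simpa using ((hasDerivAt_id t).smul_const e).const_add x
  have hdiff : ∀ᶠ y in 𝓝 x, DifferentiableAt ℝ h y := by
    filter_upwards [hh.eventually (by simp)] with y hy using hy.differentiableAt two_ne_zero
  have h1 : deriv (fun t : ℝ => h (x + t • e)) =ᶠ[𝓝 0] fun t => fderiv ℝ h (x + t • e) e := by
    filter_upwards [htend.eventually hdiff] with t ht
    exact (ht.hasFDerivAt.comp_hasDerivAt t (hline' t)).deriv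
  have hd : DifferentiableAt ℝ (fun y => fderiv ℝ h y e) x :=
    ((hh.fderiv_right (m := 1) (by norm_num)).clm_apply contDiffAt_const).differentiableAt
      one_ne_zero
  have h2 : deriv (fun t : ℝ => fderiv ℝ h (x + t • e) e) 0 = fderiv ℝ (fun y => fderiv ℝ h y e) x e := by
    have hd' : HasFDerivAt (fun y => fderiv ℝ h y e) (fderiv ℝ (fun y => fderiv ℝ h y e) x)
      (x + (0 : ℝ) • e) := by rw [hl0]; exact hd.hasFDerivAt
    exact (hd'.comp_hasDerivAt (0 : ℝ) (hline' 0)).deriv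
  rw [← h2, ← h1.deriv_eq]
  apply second_deriv_nonneg
  · have : ∀ᶠ y in 𝓝 x, h x ≤ h y := hmin
    filter_upwards [htend.eventually this] with t ht
    simpa using ht
  · have : ContinuousAt h (x + (0 : ℝ) • e) := by rw [hl0]; exact hh.continuousAt
    exact ContinuousAt.comp (g := h) (f := fun t : ℝ => x + t • e) this hline.continuousAt

lemma lap_sub_mul {m : ℕ} {f g : E m → ℝ} {x : E m} (hf : ContDiffAt ℝ 2 f x)
    (hg : ContDiffAt ℝ 2 g x) (c k : ℝ) :
    lap (fun y => f y - c * (g y - k)) x = lap f x - c * lap g x := by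
  unfold lap
  rw [Finset.mul_sum, ← Finset.sum_sub_distrib]
  refine Finset.sum_congr rfl fun i _ => ?_
  set e : E m := EuclideanSpace.single i 1
  have h1 : (fun y => fderiv ℝ (fun y => f y - c * (g y - k)) y e) =ᶠ[𝓝 x]
      fun y => fderiv ℝ f y e - c * fderiv ℝ g y e := by
    filter_upwards [hf.eventually (by simp), hg.eventually (by simp)] with y h1 h2
    have a1 := (h1.differentiableAt two_ne_zero).hasFDerivAt
    have a2 := (h2.differentiableAt two_ne_zero).hasFDerivAt
    rw [(a1.fun_sub ((a2.sub_const k).const_mul c)).fderiv]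
    simp
  have d1 : DifferentiableAt ℝ (fun y => fderiv ℝ f y e) x :=
    ((hf.fderiv_right (m := 1) (by norm_num)).clm_apply contDiffAt_const).differentiableAt
      one_ne_zero
  have d2 : DifferentiableAt ℝ (fun y => fderiv ℝ g y e) x :=
    ((hg.fderiv_right (m := 1) (by norm_num)).clm_apply contDiffAt_const).differentiableAt
      one_ne_zero
  rw [h1.fderiv_eq, (d1.hasFDerivAt.fun_sub (d2.hasFDerivAt.const_mul c)).fderiv]
  simp

/-- Gaussian barrier -/
def bar {m : ℕ} (a : ℝ) (x u : E m) : ℝ := Real.exp (-(a * ‖u - x‖ ^ 2))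

lemma bar_contDiff {m : ℕ} {n : ℕ∞} (a : ℝ) (x : E m) : ContDiff ℝ n (bar a x) := by
  unfold bar
  exact Real.contDiff_exp.comp
    ((contDiff_const.mul ((contDiff_id.sub contDiff_const).norm_sq ℝ)).neg)

lemma bar_hasFDerivAt {m : ℕ} (a : ℝ) (x u : E m) :
    HasFDerivAt (bar a x) ((-(2 * a) * bar a x u) • innerSL ℝ (u - x)) u := by
  have h1 : HasFDerivAt (fun u : E m => ‖u - x‖ ^ 2) (2 • innerSL ℝ (u - x)) u := by
    have h0 : HasFDerivAt (fun u : E m => u - x) (ContinuousLinearMap.id ℝ (E m)) u :=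
      (hasFDerivAt_id u).sub_const x
    have := (hasStrictFDerivAt_norm_sq (u - x)).hasFDerivAt.comp u h0
    exact this.congr_fderiv (by ext v; simp)
  have h2 := (h1.const_mul a).neg.exp
  refine h2.congr_fderiv ?_
  ext v
  simp [bar]
  ring

lemma bar_lap {m : ℕ} (a : ℝ) (x u : E m) :
    lap (bar a x) u = bar a x u * (4 * a ^ 2 * ‖u - x‖ ^ 2 - 2 * a * m) := by
  unfold lap
  have h1 : ∀ i : Fin m, fderiv ℝ (fun y => fderiv ℝ (bar a x) y (EuclideanSpace.single i 1)) u
      (EuclideanSpace.single i 1) = bar a x u * (4 * a ^ 2 * (u i - x i) ^ 2 - 2 * a) := by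
    intro i
    have e : (fun y => fderiv ℝ (bar a x) y (EuclideanSpace.single i 1)) =
        fun y => (-(2 * a) * bar a x y) * (y i - x i) := by
      funext y
      rw [(bar_hasFDerivAt a x y).fderiv]
      simp [EuclideanSpace.inner_single_right]
    rw [e]
    have h2 : HasFDerivAt (fun y : E m => y i - x i) (EuclideanSpace.proj i : E m →L[ℝ] ℝ) u :=
      (EuclideanSpace.proj i : E m →L[ℝ] ℝ).hasFDerivAt.sub_const _
    rw [(((bar_hasFDerivAt a x u).const_mul (-(2 * a))).fun_mul h2).fderiv]
    simp [EuclideanSpace.inner_single_right]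
    ring
  simp_rw [h1]
  rw [← Finset.mul_sum, Finset.sum_sub_distrib, ← Finset.mul_sum, EuclideanSpace.norm_sq_eq]
  simp
  ring_nf
  simp

end

open Filter Topology Metric MeasureTheory
noncomputable section

lemma hopf {m : ℕ} {U : Set (E m)} {f : E m → ℝ} (hf : HarmOn U f) (hU : IsOpen U)
    {x y : E m} {d M : ℝ} (hd : 0 < d) (hy : dist y x = d) (hB : closedBall x d ⊆ U)
    (hpos : ∀ u ∈ ball x d, 0 < f u) (hy0 : f y = 0) (hM : ‖fderiv ℝ f y‖ ≤ M) :
    f x ≤ (2 ^ m * Real.exp (128 * (m + 1))) * (M * d) := by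
  set α : ℝ := 128 * (m + 1) with hα
  have hα0 : 128 ≤ α := by
    have : (0 : ℝ) ≤ m := Nat.cast_nonneg m
    rw [hα]; linarith
  have hxU : x ∈ ball x d := mem_ball_self hd
  set ε : ℝ := f x / 2 ^ m with hε
  have hε0 : 0 < ε := div_pos (hpos x hxU) (by positivity)
  set a : ℝ := α / d ^ 2 with ha
  have ha0 : 0 < a := by positivity
  have had : a * d ^ 2 = α := by rw [ha]; field_simp
  have hnonneg : ∀ u ∈ closedBall x d, 0 ≤ f u := by
    have h1 : Set.MapsTo f (ball x d) (Set.Ici 0) := fun u hu => (hpos u hu).le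
    have h2 := h1.closure_of_continuousOn
      (by rw [closure_ball x hd.ne']; exact hf.1.continuousOn.mono hB)
    rw [closure_ball x hd.ne', isClosed_Ici.closure_eq] at h2
    exact fun u hu => h2 hu
  have hin : ∀ u ∈ closedBall x (d / 16), ε ≤ f u := by
    intro u hu
    simp only [mem_closedBall] at hu
    rw [hε, div_le_iff₀ (by positivity), mul_comm]
    apply harnack hf hU (R := d / 4) (R' := 3 * d / 4) (by linarith) (by linarith)
    · exact (closedBall_subset_closedBall' (by linarith)).trans hB
    · intro v hv
      apply hnonneg
      simp only [mem_ball] at hv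
      simp only [mem_closedBall]
      linarith [dist_triangle v u x]
    · rw [dist_comm]; linarith
  set g : E m → ℝ := fun u => f u - ε * (bar a x u - Real.exp (-α)) with hg
  set A : Set (E m) := closedBall x d \ ball x (d / 16) with hA
  have hAc : IsCompact A := (isCompact_closedBall x d).diff isOpen_ball
  have hyA : y ∈ A := by
    simp only [hA, Set.mem_sdiff, mem_closedBall, mem_ball, hy]
    constructor <;> linarith
  have hfC : ∀ u ∈ A, ContDiffAt ℝ 2 f u := fun u hu => hf.1.contDiffAt (hU.mem_nhds (hB hu.1))
  have hbC : ∀ u, ContDiffAt ℝ 2 (bar a x) u := fun u => (bar_contDiff (n := 2) a x).contDiffAt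
  have hgC : ∀ u ∈ A, ContDiffAt ℝ 2 g u := fun u hu =>
    (hfC u hu).sub (contDiffAt_const.mul ((hbC u).sub contDiffAt_const))
  have hbar : ∀ u, bar a x u = Real.exp (-(a * dist u x ^ 2)) := fun u => by
    rw [dist_eq_norm]; rfl
  have hmain : ∀ u ∈ A, 0 ≤ g u := by
    obtain ⟨u0, hu0, hmin⟩ := hAc.exists_isMinOn ⟨y, hyA⟩
      (fun u hu => (hgC u hu).continuousAt.continuousWithinAt)
    suffices h0 : 0 ≤ g u0 from fun u hu => h0.trans (hmin hu)
    by_contra hneg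
    push Not at hneg
    have hu1 : dist u0 x ≤ d := hu0.1
    have hu2 : d / 16 ≤ dist u0 x := by simpa using hu0.2
    have hu3 : dist u0 x < d := by
      refine lt_of_le_of_ne hu1 fun he => ?_
      have : g u0 = f u0 := by
        simp only [hg, hbar, he, had]; ring
      linarith [hnonneg u0 hu0.1]
    have hu4 : d / 16 < dist u0 x := by
      refine lt_of_le_of_ne hu2 fun he => ?_
      have h1 := hin u0 (by simp [← he])
      have h2 : bar a x u0 ≤ 1 := by
        rw [hbar, Real.exp_le_one_iff]
        have : 0 ≤ a * dist u0 x ^ 2 := by positivity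
        linarith
      have h3 := Real.exp_pos (-α)
      have : ε * (bar a x u0 - Real.exp (-α)) ≤ ε * 1 := by gcongr; linarith
      simp only [hg] at hneg
      linarith
    have hloc : IsLocalMin g u0 := by
      apply hmin.isLocalMin
      have : ball x d ∩ (closedBall x (d / 16))ᶜ ∈ 𝓝 u0 :=
        (isOpen_ball.inter isClosed_closedBall.isOpen_compl).mem_nhds ⟨hu3, by simpa using hu4⟩
      refine mem_of_superset this ?_
      rintro v ⟨hv1, hv2⟩
      simp only [mem_ball] at hv1
      simp at hv2
      simp only [hA, Set.mem_sdiff, mem_closedBall, mem_ball]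
      constructor <;> linarith
    have hl := locmin_lap (hgC u0 hu0) hloc
    rw [hg, lap_sub_mul (hfC u0 hu0) (hbC u0), hf.2 u0 (hB hu0.1), bar_lap, ← dist_eq_norm] at hl
    have hb0 : 0 < bar a x u0 := Real.exp_pos _
    have h5 : 2 * a * (m + 1) ≤ 4 * a ^ 2 * dist u0 x ^ 2 := by
      have h6 : (d / 16) ^ 2 ≤ dist u0 x ^ 2 := by gcongr
      have h7 : 4 * a ^ 2 * (d / 16) ^ 2 = 2 * a * (m + 1) := by
        have : 4 * a ^ 2 * (d / 16) ^ 2 = 4 / 256 * a * (a * d ^ 2) := by ring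
        rw [this, had, hα]; ring
      rw [← h7]; gcongr
    have h8 : 0 < 4 * a ^ 2 * dist u0 x ^ 2 - 2 * a * m := by nlinarith
    have : 0 < ε * (bar a x u0 * (4 * a ^ 2 * dist u0 x ^ 2 - 2 * a * m)) := by positivity
    linarith
  -- derivative at the boundary point
  have hyU : y ∈ U := hB hyA.1
  have hline : HasDerivAt (fun t : ℝ => y + t • (x - y)) (x - y) 0 := by
    simpa using ((hasDerivAt_id (0 : ℝ)).smul_const (x - y)).const_add y
  have hfd : HasFDerivAt f (fderiv ℝ f y) (y + (0 : ℝ) • (x - y)) := by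
    simpa using ((hfC y hyA).differentiableAt two_ne_zero).hasFDerivAt
  have hder := hfd.comp_hasDerivAt (0 : ℝ) hline
  have hts := hder.tendsto_slope_zero_right
  have hge : ε * (Real.exp (-α) * α) ≤ fderiv ℝ f y (x - y) := by
    refine ge_of_tendsto hts ?_
    have : Set.Ioc (0 : ℝ) (15 / 16) ∈ 𝓝[>] (0 : ℝ) := Ioc_mem_nhdsGT (by norm_num)
    filter_upwards [this] with t ht
    have hdist : dist (y + t • (x - y)) x = (1 - t) * d := by
      rw [dist_eq_norm]
      have : y + t • (x - y) - x = (1 - t) • (y - x) := by module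
      rw [this, norm_smul, ← dist_eq_norm y x, hy, Real.norm_of_nonneg (by linarith [ht.2])]
    have hmem : y + t • (x - y) ∈ A := by
      simp only [hA, Set.mem_sdiff, mem_closedBall, mem_ball, hdist]
      constructor <;> nlinarith [ht.1, ht.2]
    have h1 := hmain _ hmem
    simp only [hg, hbar, hdist] at h1
    have h2 : a * ((1 - t) * d) ^ 2 = α * (1 - t) ^ 2 := by rw [← had]; ring
    rw [h2] at h1
    have h3 : Real.exp (-(α * (1 - t) ^ 2)) = Real.exp (-α) * Real.exp (α * (2 * t - t ^ 2)) := by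
      rw [← Real.exp_add]; congr 1; ring
    have h4 := Real.add_one_le_exp (α * (2 * t - t ^ 2))
    have h5 : α * t ≤ α * (2 * t - t ^ 2) := by
      have := ht.1
      gcongr
      nlinarith [ht.1, ht.2]
    have h6 : Real.exp (-α) * (α * t) ≤ Real.exp (-(α * (1 - t) ^ 2)) - Real.exp (-α) := by
      rw [h3]
      have := Real.exp_pos (-α)
      nlinarith
    have h7 : ε * (Real.exp (-α) * (α * t)) ≤ f (y + t • (x - y)) := by
      have := mul_le_mul_of_nonneg_left h6 hε0.le
      linarith
    simp only [Function.comp, zero_add, zero_smul, add_zero, hy0, sub_zero, smul_eq_mul]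
    rw [inv_mul_eq_div, le_div_iff₀ ht.1]
    linarith
  have hle : fderiv ℝ f y (x - y) ≤ M * d := by
    refine (le_abs_self _).trans ?_
    refine ((fderiv ℝ f y).le_opNorm (x - y)).trans ?_
    rw [← dist_eq_norm, dist_comm, hy]
    gcongr
  have h9 : ε * Real.exp (-α) ≤ M * d := by
    refine le_trans ?_ (hge.trans hle)
    have := Real.exp_pos (-α)
    have h10 : 0 < ε * Real.exp (-α) := by positivity
    nlinarith
  rw [hε, Real.exp_neg, ← div_eq_mul_inv, div_le_iff₀ (Real.exp_pos _),
    div_le_iff₀ (by positivity)] at h9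
  linarith

lemma HarmOn.neg' {m : ℕ} {U : Set (E m)} {f : E m → ℝ} (hf : HarmOn U f) :
    HarmOn U (fun x => - f x) := by
  refine ⟨hf.1.neg, fun x hx => ?_⟩
  have := hf.2 x hx
  unfold lap at this ⊢
  simp only [fderiv_fun_neg, neg_apply, Finset.sum_neg_distrib, this, neg_zero]

lemma HarmOn.sub_const' {m : ℕ} {U : Set (E m)} {f : E m → ℝ} (hf : HarmOn U f) (c : ℝ) :
    HarmOn U (fun x => f x - c) := by
  refine ⟨hf.1.sub contDiffOn_const, fun x hx => ?_⟩
  have := hf.2 x hx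
  unfold lap at this ⊢
  simpa only [fderiv_sub_const] using this

/-- The normalised family: harmonic, gradient at most `M` on the zero set. -/
def Fam0 {m : ℕ} (U : Set (E m)) (M : ℝ) (f : E m → ℝ) : Prop :=
  HarmOn U f ∧ ∀ x ∈ U, f x = 0 → ‖fderiv ℝ f x‖ ≤ M

lemma Fam0.neg {m : ℕ} {U : Set (E m)} {M : ℝ} {f : E m → ℝ} (hf : Fam0 U M f) :
    Fam0 U M (fun x => - f x) := by
  refine ⟨hf.1.neg', fun x hx h0 => ?_⟩
  rw [fderiv_fun_neg, norm_neg]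
  exact hf.2 x hx (by simpa using h0)

lemma sign_ball {m : ℕ} {f : E m → ℝ} {x : E m} {r : ℝ} (hc : ContinuousOn f (ball x r))
    (h0 : ∀ u ∈ ball x r, f u ≠ 0) {w z : E m} (hw : w ∈ ball x r) (hz : z ∈ ball x r)
    (hp : 0 < f w) : 0 < f z := by
  by_contra hn
  push Not at hn
  have hcon : IsPreconnected (ball x r) := (convex_ball x r).isPreconnected
  obtain ⟨v, hv, hv0⟩ := hcon.intermediate_value hz hw hc ⟨hn, hp.le⟩
  exact h0 v hv hv0

/-- If there is a zero near `x` then `f x` is bounded. -/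
lemma zero_bound_pos {m : ℕ} {U : Set (E m)} {M : ℝ} {f : E m → ℝ} (hU : IsOpen U)
    (hf : Fam0 U M f) {x p : E m} {D : ℝ} (hB : closedBall x D ⊆ U) (hp : f p = 0)
    (hpD : dist p x ≤ D) (hM : 0 ≤ M) (hx : 0 < f x) :
    f x ≤ (2 ^ m * Real.exp (128 * (m + 1))) * (M * D) := by
  have hfc := hf.1.1.continuousOn.mono hB
  have hZc : IsCompact (closedBall x D ∩ f ⁻¹' {0}) := by
    apply IsCompact.of_isClosed_subset (isCompact_closedBall x D) _ Set.inter_subset_left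
    exact hfc.preimage_isClosed_of_isClosed isClosed_closedBall isClosed_singleton
  obtain ⟨y, hyZ, hymin⟩ := hZc.exists_isMinOn ⟨p, hpD, hp⟩
    (f := fun u => dist u x) (by fun_prop)
  have hy0 : f y = 0 := hyZ.2
  have hyD : dist y x ≤ D := hyZ.1
  have hd : 0 < dist y x := by
    rw [dist_pos]
    rintro rfl
    linarith
  have hB' : closedBall x (dist y x) ⊆ U := (closedBall_subset_closedBall hyD).trans hB
  have h1 := hopf hf.1 hU (M := M) hd rfl hB' (by
    intro u hu
    refine sign_ball (hf.1.1.continuousOn.mono (ball_subset_closedBall.trans hB')) ?_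
      (mem_ball_self hd) hu hx
    intro v hv hv0
    have : dist y x ≤ dist v x := hymin ⟨by
      simp only [mem_ball] at hv
      simp only [mem_closedBall]; linarith, hv0⟩
    simp only [mem_ball] at hv
    linarith) hy0 (hf.2 y (hB hyD) hy0)
  refine h1.trans ?_
  gcongr

lemma zero_bound {m : ℕ} {U : Set (E m)} {M : ℝ} {f : E m → ℝ} (hU : IsOpen U)
    (hf : Fam0 U M f) {x p : E m} {D : ℝ} (hB : closedBall x D ⊆ U) (hp : f p = 0)
    (hpD : dist p x ≤ D) (hM : 0 ≤ M) :
    |f x| ≤ (2 ^ m * Real.exp (128 * (m + 1))) * (M * D) := by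
  have hD : 0 ≤ D := dist_nonneg.trans hpD
  rcases lt_trichotomy (f x) 0 with h | h | h
  · rw [abs_of_neg h]
    exact zero_bound_pos hU hf.neg hB (by simpa using hp) hpD hM (by simpa using h)
  · rw [h, abs_zero]; positivity
  · rw [abs_of_pos h]
    exact zero_bound_pos hU hf hB hp hpD hM h

/-- Local comparison of values of members of the family. -/
lemma local_comp {m : ℕ} {U : Set (E m)} {M : ℝ} (hU : IsOpen U) (hM : 0 ≤ M) {x : E m}
    (hx : x ∈ U) : ∃ r > 0, ∃ C ≥ 1, ball x r ⊆ U ∧ ∀ f : E m → ℝ, Fam0 U M f →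
      ∀ z ∈ ball x r, ∀ w ∈ ball x r, |f z| ≤ C * (|f w| + 1) ∧
        (C < f w → f w ≤ C * (f z + 1)) := by
  obtain ⟨R, hR, hRU⟩ := Metric.nhds_basis_closedBall.mem_iff.1 (hU.mem_nhds hx)
  set K : ℝ := (2 ^ m * Real.exp (128 * (m + 1))) * (M * (3 * R / 4)) with hK
  have hK0 : 0 ≤ K := by positivity
  have hsub : ∀ z ∈ ball x (R / 32), ∀ s ≤ 3 * R / 4, closedBall z s ⊆ U := by
    intro z hz s hs
    simp only [mem_ball] at hz
    exact (closedBall_subset_closedBall' (by linarith)).trans hRU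
  have h2m : (1 : ℝ) ≤ 2 ^ m := one_le_pow₀ (by norm_num)
  have key : ∀ f : E m → ℝ, Fam0 U M f → ∀ z ∈ ball x (R / 32), ∀ w ∈ ball x (R / 32),
      |f z| ≤ 2 ^ m * |f w| + K := by
    intro f hf z hz w hw
    have hzw : dist z w ≤ R / 16 := by
      simp only [mem_ball] at hz hw
      linarith [dist_triangle_right z w x]
    by_cases hp : ∃ p ∈ ball w (2 * (R / 4)), f p = 0
    swap
    · push Not at hp
      -- Harnack
      have hcw : ContinuousOn f (ball w (2 * (R / 4))) :=
        hf.1.1.continuousOn.mono (ball_subset_closedBall.trans (hsub w hw _ (by linarith)))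
      have hwm : w ∈ ball w (2 * (R / 4)) := mem_ball_self (by linarith)
      have hzm : z ∈ ball w (2 * (R / 4)) := by simp only [mem_ball]; linarith
      have : |f z| ≤ 2 ^ m * |f w| := by
        rcases lt_or_gt_of_ne (hp w hwm) with h | h
        · have hs : ∀ u ∈ ball w (2 * (R / 4)), 0 < - f u := fun u hu =>
            sign_ball hcw.neg (fun v hv => by simpa using hp v hv) hwm hu
              (by simpa using h)
          have := harnack hf.1.neg' hU (z := w) (w := z) (R := R / 4) (R' := 3 * R / 4)
            (by linarith) (by linarith) (hsub w hw _ le_rfl) (fun u hu => (hs u hu).le)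
            (by linarith)
          rw [abs_of_neg h, abs_of_neg (by simpa using hs z hzm)]
          exact this
        · have hs : ∀ u ∈ ball w (2 * (R / 4)), 0 < f u := fun u hu =>
            sign_ball hcw hp hwm hu h
          have := harnack hf.1 hU (z := w) (w := z) (R := R / 4) (R' := 3 * R / 4)
            (by linarith) (by linarith) (hsub w hw _ le_rfl) (fun u hu => (hs u hu).le)
            (by linarith)
          rw [abs_of_pos h, abs_of_pos (hs z hzm)]
          exact this
      linarith
    · obtain ⟨p, hp, hp0⟩ := hp
      have h1 := zero_bound hU hf (x := z) (p := p) (D := 3 * R / 4) (hsub z hz _ le_rfl) hp0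
        (by
          simp only [mem_ball] at hp
          linarith [dist_triangle p w z, dist_comm z w]) hM
      have h2 : |f z| ≤ K := h1
      have : 0 ≤ 2 ^ m * |f w| := by positivity
      linarith
  have key2 : ∀ f : E m → ℝ, Fam0 U M f → ∀ z ∈ ball x (R / 32), ∀ w ∈ ball x (R / 32),
      |f z| ≤ (2 ^ m + K) * (|f w| + 1) := by
    intro f hf z hz w hw
    have h1 := key f hf z hz w hw
    have h2 : 0 ≤ K * |f w| := by positivity
    nlinarith
  have hbU : ball x (R / 32) ⊆ U :=
    (ball_subset_closedBall.trans (closedBall_subset_closedBall (by linarith))).trans hRU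
  refine ⟨R / 32, by linarith, 2 ^ m + K, by linarith, hbU, ?_⟩
  intro f hf z hz w hw
  refine ⟨key2 f hf z hz w hw, fun hlt => ?_⟩
  have hw0 : 0 < f w := by linarith
  have hz0 : 0 < f z := by
    refine sign_ball (hf.1.1.continuousOn.mono hbU) ?_ hw hz hw0
    intro v hv hv0
    have := key2 f hf w hw v hv
    rw [hv0, abs_zero, abs_of_pos hw0] at this
    linarith
  have := key2 f hf w hw z hz
  rwa [abs_of_pos hw0, abs_of_pos hz0] at this

end

open Filter Topology Metric MeasureTheory
noncomputable section

lemma glob_top {m : ℕ} {U : Set (E m)} {M : ℝ} (hU : IsOpen U) (hUc : IsPreconnected U)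
    (hM : 0 ≤ M) {f : ℕ → E m → ℝ} (hf : ∀ n, Fam0 U M (f n)) {p : E m} (hp : p ∈ U)
    (ht : Tendsto (fun n => f n p) atTop atTop) {K : Set (E m)} (hK : IsCompact K) (hKU : K ⊆ U)
    (A : ℝ) : ∀ᶠ n in atTop, ∀ x ∈ K, A ≤ f n x := by
  have hpt : ∀ x ∈ U, Tendsto (fun n => f n x) atTop atTop := by
    intro x hx
    have := hUc.induction₂ (fun x y => Tendsto (fun n => f n x) atTop atTop ↔
      Tendsto (fun n => f n y) atTop atTop) ?_ (fun _ _ _ _ _ _ h1 h2 => h1.trans h2)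
      (fun _ _ _ _ h => h.symm) hp hx
    · exact this.1 ht
    · intro x hx
      obtain ⟨r, hr, C, hC, hsub, h⟩ := local_comp hU hM hx
      have aux : ∀ z ∈ ball x r, ∀ w ∈ ball x r, Tendsto (fun n => f n w) atTop atTop →
          Tendsto (fun n => f n z) atTop atTop := by
        intro z hz w hw hw'
        rw [Filter.tendsto_atTop] at hw' ⊢
        intro b
        filter_upwards [hw' (C + 1), hw' (C * (b + 1))] with n h1 h2
        have h3 := (h (f n) (hf n) z hz w hw).2 (by linarith)
        have := le_of_mul_le_mul_left (h2.trans h3) (by linarith)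
        linarith
      filter_upwards [mem_nhdsWithin_of_mem_nhds (ball_mem_nhds x hr)] with y hy
      exact ⟨aux y hy x (mem_ball_self hr), aux x (mem_ball_self hr) y hy⟩
  refine hK.induction_on (p := fun S => ∀ᶠ n in atTop, ∀ x ∈ S, A ≤ f n x) (by simp) ?_ ?_ ?_
  · intro s t hst h
    filter_upwards [h] with n hn x hx using hn x (hst hx)
  · intro s t hs ht
    filter_upwards [hs, ht] with n h1 h2 x hx
    exact hx.elim (h1 x) (h2 x)
  · intro x hx
    obtain ⟨r, hr, C, hC, hsub, h⟩ := local_comp hU hM (hKU hx)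
    refine ⟨ball x r, mem_nhdsWithin_of_mem_nhds (ball_mem_nhds x hr), ?_⟩
    have hw' := hpt x (hKU hx)
    rw [Filter.tendsto_atTop] at hw'
    filter_upwards [hw' (C + 1), hw' (C * (A + 1))] with n h1 h2 z hz
    have h3 := (h (f n) (hf n) z hz x (mem_ball_self hr)).2 (by linarith)
    have := le_of_mul_le_mul_left (h2.trans h3) (by linarith)
    linarith

lemma glob_bdd {m : ℕ} {U : Set (E m)} {M : ℝ} (hU : IsOpen U) (hUc : IsPreconnected U)
    (hM : 0 ≤ M) {f : ℕ → E m → ℝ} (hf : ∀ n, Fam0 U M (f n)) {p : E m} (hp : p ∈ U)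
    (ht : ∃ B, ∀ n, |f n p| ≤ B) {K : Set (E m)} (hK : IsCompact K) (hKU : K ⊆ U) :
    ∃ B, ∀ n, ∀ x ∈ K, |f n x| ≤ B := by
  have hpt : ∀ x ∈ U, ∃ B, ∀ n, |f n x| ≤ B := by
    intro x hx
    have := hUc.induction₂ (fun x y => (∃ B, ∀ n, |f n x| ≤ B) ↔ (∃ B, ∀ n, |f n y| ≤ B))
      ?_ (fun _ _ _ _ _ _ h1 h2 => h1.trans h2)
      (fun _ _ _ _ h => h.symm) hp hx
    · exact this.1 ht
    · intro x hx
      obtain ⟨r, hr, C, hC, hsub, h⟩ := local_comp hU hM hx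
      have aux : ∀ z ∈ ball x r, ∀ w ∈ ball x r, (∃ B, ∀ n, |f n w| ≤ B) →
          (∃ B, ∀ n, |f n z| ≤ B) := by
        rintro z hz w hw ⟨B, hB⟩
        refine ⟨C * (B + 1), fun n => ((h (f n) (hf n) z hz w hw).1).trans ?_⟩
        gcongr
        exact hB n
      filter_upwards [mem_nhdsWithin_of_mem_nhds (ball_mem_nhds x hr)] with y hy
      exact ⟨aux y hy x (mem_ball_self hr), aux x (mem_ball_self hr) y hy⟩
  refine hK.induction_on (p := fun S => ∃ B, ∀ n, ∀ x ∈ S, |f n x| ≤ B) (by simp) ?_ ?_ ?_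
  · rintro s t hst ⟨B, h⟩
    exact ⟨B, fun n x hx => h n x (hst hx)⟩
  · rintro s t ⟨B1, h1⟩ ⟨B2, h2⟩
    refine ⟨max B1 B2, fun n x hx => ?_⟩
    rcases hx with hx | hx
    · exact (h1 n x hx).trans (le_max_left _ _)
    · exact (h2 n x hx).trans (le_max_right _ _)
  · intro x hx
    obtain ⟨r, hr, C, hC, hsub, h⟩ := local_comp hU hM (hKU hx)
    refine ⟨ball x r, mem_nhdsWithin_of_mem_nhds (ball_mem_nhds x hr), ?_⟩
    obtain ⟨B, hB⟩ := hpt x (hKU hx)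
    refine ⟨C * (B + 1), fun n z hz => ((h (f n) (hf n) z hz x (mem_ball_self hr)).1).trans ?_⟩
    gcongr
    exact hB n

lemma loc_rep {m : ℕ} {U : Set (E m)} {f : E m → ℝ} (hU : IsOpen U) (hf : HarmOn U f)
    {x w : E m} {r : ℝ} (hr : 0 < r) (hB : closedBall x (3 * r) ⊆ U) (hw : w ∈ ball x r) :
    ∫ u in closedBall x (3 * r), f u * kr (r⁻¹ • (w - u)) = f w * (r ^ m * ∫ y : E m, kr y) := by
  simp only [mem_ball] at hw
  rw [← mv hf hU w hr (by linarith : r < 3 * r / 2)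
    ((closedBall_subset_closedBall' (by linarith)).trans hB)]
  apply setIntegral_eq_integral_of_forall_compl_eq_zero
  intro u hu
  simp only [mem_closedBall, not_le] at hu
  rw [kr_zero' hr (by linarith [dist_triangle u w x]), mul_zero]

lemma equi {m : ℕ} {U : Set (E m)} (hU : IsOpen U) {f : ℕ → E m → ℝ} (hf : ∀ n, HarmOn U (f n))
    (hb : ∀ K ⊆ U, IsCompact K → ∃ B, ∀ n, ∀ x ∈ K, |f n x| ≤ B) {x : E m} (hx : x ∈ U) :
    ∃ r > 0, ∃ L ≥ 0, ball x r ⊆ U ∧ ∀ n, ∀ z ∈ ball x r, ∀ w ∈ ball x r,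
      |f n z - f n w| ≤ L * dist z w := by
  obtain ⟨R, hR, hRU⟩ := Metric.nhds_basis_closedBall.mem_iff.1 (hU.mem_nhds hx)
  obtain ⟨r, hr, hrR⟩ : ∃ r > 0, 3 * r = R := ⟨R / 3, by linarith, by ring⟩
  subst hrR
  obtain ⟨B, hB⟩ := hb _ hRU (isCompact_closedBall _ _)
  obtain ⟨Lp, hLp⟩ := (kr_contDiff (m := m) (n := 1)).lipschitzWith_of_hasCompactSupport
    kr_compact one_ne_zero
  have hkC : Continuous (kr : E m → ℝ) := (kr_contDiff (n := 0)).continuous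
  set c : ℝ := r ^ m * ∫ y : E m, kr y with hc
  have hc0 : 0 < c := mul_pos (by positivity) kr_int_pos
  have hB0 : 0 ≤ B := (abs_nonneg _).trans (hB 0 x (mem_closedBall_self (by linarith)))
  set V : ℝ := volume.real (closedBall x (3 * r)) with hV
  refine ⟨r, hr, B * (Lp * r⁻¹) * V / c, by positivity,
    (ball_subset_closedBall.trans (closedBall_subset_closedBall (by linarith))).trans hRU, ?_⟩
  intro n z hz w hw
  have hIg : ∀ v : E m, IntegrableOn (fun u => f n u * kr (r⁻¹ • (v - u)))
      (closedBall x (3 * r)) := fun v =>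
    ContinuousOn.integrableOn_compact (isCompact_closedBall _ _)
      (((hf n).1.continuousOn.mono hRU).mul (by fun_prop))
  have e : (f n z - f n w) * c = ∫ u in closedBall x (3 * r),
      f n u * (kr (r⁻¹ • (z - u)) - kr (r⁻¹ • (w - u))) := by
    simp_rw [mul_sub]
    rw [integral_sub (hIg z) (hIg w), loc_rep hU (hf n) hr hRU hz, loc_rep hU (hf n) hr hRU hw]
    ring
  have hle := norm_setIntegral_le_of_norm_le_const (μ := volume) (s := closedBall x (3 * r))
    (f := fun u => f n u * (kr (r⁻¹ • (z - u)) - kr (r⁻¹ • (w - u))))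
    (C := B * (Lp * r⁻¹ * dist z w)) measure_closedBall_lt_top (by
      intro u hu
      rw [norm_mul]
      have h1 := hLp.dist_le_mul (r⁻¹ • (z - u)) (r⁻¹ • (w - u))
      rw [dist_smul₀, dist_sub_right, norm_inv, Real.norm_of_nonneg hr.le, dist_eq_norm] at h1
      have h2 : ‖f n u‖ ≤ B := hB n u hu
      rw [mul_assoc (Lp : ℝ)]
      gcongr)
  rw [← e, norm_mul, Real.norm_eq_abs, Real.norm_of_nonneg hc0.le, ← le_div_iff₀ hc0] at hle
  refine hle.trans (le_of_eq ?_)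
  rw [← hV]
  ring

lemma subseq_pt {m : ℕ} {U : Set (E m)} (hU : IsOpen U) {f : ℕ → E m → ℝ}
    (hf : ∀ n, HarmOn U (f n))
    (hb : ∀ K ⊆ U, IsCompact K → ∃ B, ∀ n, ∀ x ∈ K, |f n x| ≤ B) :
    ∃ φ : ℕ → ℕ, StrictMono φ ∧ ∃ g : E m → ℝ, ∀ x ∈ U,
      Tendsto (fun n => f (φ n) x) atTop (𝓝 (g x)) := by
  let D := {k : ℕ // TopologicalSpace.denseSeq (E m) k ∈ U}
  have hbD : ∀ d : D, ∃ B, ∀ n, |f n (TopologicalSpace.denseSeq (E m) d.1)| ≤ B := by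
    intro d
    obtain ⟨B, hB⟩ := hb {TopologicalSpace.denseSeq (E m) d.1} (by simpa using d.2)
      isCompact_singleton
    exact ⟨B, fun n => hB n _ rfl⟩
  choose B hB using hbD
  obtain ⟨a, -, φ, hφ, hlim⟩ := (isCompact_univ_pi fun d : D => isCompact_Icc (a := - B d)
    (b := B d)).tendsto_subseq (x := fun n d => f n (TopologicalSpace.denseSeq (E m) d.1))
    (fun n d _ => abs_le.1 (hB d n))
  rw [tendsto_pi_nhds] at hlim
  have hlimpt : ∀ x ∈ U, ∃ y, Tendsto (fun n => f (φ n) x) atTop (𝓝 y) := by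
    intro x hx
    apply cauchySeq_tendsto_of_complete
    rw [Metric.cauchySeq_iff']
    intro ε hε
    obtain ⟨r, hr, L, hL, hrU, h⟩ := equi hU hf hb hx
    have hs : 0 < min r (ε / (4 * (L + 1))) := lt_min hr (by positivity)
    obtain ⟨k, hk⟩ := (TopologicalSpace.denseRange_denseSeq (E m)).exists_mem_open
      isOpen_ball ⟨x, mem_ball_self hs⟩
    have hkr := ball_subset_ball (min_le_left _ _) hk
    have hke : dist (TopologicalSpace.denseSeq (E m) k) x < ε / (4 * (L + 1)) :=
      ball_subset_ball (min_le_right _ _) hk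
    have hbd : ∀ n, |f n x - f n (TopologicalSpace.denseSeq (E m) k)| ≤ ε / 4 := by
      intro n
      refine (h n x (mem_ball_self hr) _ hkr).trans ?_
      rw [dist_comm]
      rw [lt_div_iff₀ (by positivity)] at hke
      nlinarith [dist_nonneg (x := TopologicalSpace.denseSeq (E m) k) (y := x)]
    have hca := (hlim ⟨k, hrU hkr⟩).cauchySeq
    rw [Metric.cauchySeq_iff'] at hca
    obtain ⟨N, hN⟩ := hca (ε / 4) (by positivity)
    refine ⟨N, fun n hn => ?_⟩
    have h1 := hN n hn
    simp only [Function.comp, Real.dist_eq] at h1 ⊢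
    have h2 := hbd (φ n)
    have h3 := hbd (φ N)
    rw [abs_le] at h2 h3
    rw [abs_lt] at h1 ⊢
    constructor <;> linarith [h1.1, h1.2, h2.1, h2.2, h3.1, h3.2]
  choose! g hg using hlimpt
  exact ⟨φ, hφ, g, hg⟩

lemma lim_lip {m : ℕ} {U : Set (E m)} (hU : IsOpen U) {f : ℕ → E m → ℝ}
    (hf : ∀ n, HarmOn U (f n))
    (hb : ∀ K ⊆ U, IsCompact K → ∃ B, ∀ n, ∀ x ∈ K, |f n x| ≤ B) {g : E m → ℝ}
    (hg : ∀ x ∈ U, Tendsto (fun n => f n x) atTop (𝓝 (g x))) {x : E m} (hx : x ∈ U) :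
    ∃ r > 0, ∃ L ≥ 0, ball x r ⊆ U ∧ (∀ n, ∀ z ∈ ball x r, ∀ w ∈ ball x r,
      |f n z - f n w| ≤ L * dist z w) ∧ ∀ z ∈ ball x r, ∀ w ∈ ball x r,
      |g z - g w| ≤ L * dist z w := by
  obtain ⟨r, hr, L, hL, hrU, h⟩ := equi hU hf hb hx
  refine ⟨r, hr, L, hL, hrU, h, fun z hz w hw => ?_⟩
  have : Tendsto (fun n => |f n z - f n w|) atTop (𝓝 |g z - g w|) :=
    ((hg z (hrU hz)).sub (hg w (hrU hw))).abs
  exact le_of_tendsto this (Eventually.of_forall fun n => h n z hz w hw)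

lemma lim_unif {m : ℕ} {U : Set (E m)} (hU : IsOpen U) {f : ℕ → E m → ℝ}
    (hf : ∀ n, HarmOn U (f n))
    (hb : ∀ K ⊆ U, IsCompact K → ∃ B, ∀ n, ∀ x ∈ K, |f n x| ≤ B) {g : E m → ℝ}
    (hg : ∀ x ∈ U, Tendsto (fun n => f n x) atTop (𝓝 (g x)))
    {K : Set (E m)} (hK : IsCompact K) (hKU : K ⊆ U) {ε : ℝ} (hε : 0 < ε) :
    ∀ᶠ n in atTop, ∀ x ∈ K, |f n x - g x| < ε := by
  refine hK.induction_on (p := fun S => ∀ᶠ n in atTop, ∀ x ∈ S, |f n x - g x| < ε) (by simp) ?_ ?_ ?_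
  · intro s t hst h
    filter_upwards [h] with n hn x hx using hn x (hst hx)
  · intro s t hs ht
    filter_upwards [hs, ht] with n h1 h2 x hx
    exact hx.elim (h1 x) (h2 x)
  · intro x hx
    obtain ⟨r, hr, L, hL, hrU, h1, h2⟩ := lim_lip hU hf hb hg (hKU hx)
    have hs : 0 < min r (ε / (4 * (L + 1))) := lt_min hr (by positivity)
    refine ⟨ball x (min r (ε / (4 * (L + 1)))),
      mem_nhdsWithin_of_mem_nhds (ball_mem_nhds x hs), ?_⟩
    have hx' := hg x (hKU hx)
    rw [Metric.tendsto_nhds] at hx'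
    filter_upwards [hx' (ε / 4) (by positivity)] with n hn z hz
    have hzr := ball_subset_ball (min_le_left _ _) hz
    have hze : dist z x < ε / (4 * (L + 1)) := ball_subset_ball (min_le_right _ _) hz
    have hLd : L * dist z x ≤ ε / 4 := by
      rw [lt_div_iff₀ (by positivity)] at hze
      nlinarith [dist_nonneg (x := z) (y := x)]
    have h3 := (h1 n z hzr x (mem_ball_self hr)).trans hLd
    have h4 := (h2 z hzr x (mem_ball_self hr)).trans hLd
    rw [Real.dist_eq] at hn
    rw [abs_le] at h3 h4
    rw [abs_lt] at hn ⊢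
    constructor <;> linarith [h3.1, h3.2, h4.1, h4.2, hn.1, hn.2]

lemma lim_cont {m : ℕ} {U : Set (E m)} (hU : IsOpen U) {f : ℕ → E m → ℝ}
    (hf : ∀ n, HarmOn U (f n))
    (hb : ∀ K ⊆ U, IsCompact K → ∃ B, ∀ n, ∀ x ∈ K, |f n x| ≤ B) {g : E m → ℝ}
    (hg : ∀ x ∈ U, Tendsto (fun n => f n x) atTop (𝓝 (g x))) : ContinuousOn g U := by
  intro x hx
  apply ContinuousAt.continuousWithinAt
  obtain ⟨r, hr, L, hL, hrU, h1, h2⟩ := lim_lip hU hf hb hg hx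
  have hlip : LipschitzOnWith ⟨L, hL⟩ g (ball x r) :=
    LipschitzOnWith.of_dist_le_mul fun z hz w hw => h2 z hz w hw
  exact hlip.continuousOn.continuousAt (ball_mem_nhds x hr)

end

open Filter Topology Metric MeasureTheory
noncomputable section

lemma conv_fderiv {m : ℕ} {H k : E m → ℝ} (hH : LocallyIntegrable H volume)
    (hk : ContDiff ℝ 1 k) (hkc : HasCompactSupport k) (w v : E m) :
    fderiv ℝ (fun w => ∫ u, H u * k (w - u)) w v = ∫ u, H u * fderiv ℝ k (w - u) v := by
  have h1 := hkc.hasFDerivAt_convolution_right (ContinuousLinearMap.mul ℝ ℝ) hH hk w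
  have e : (convolution H k (ContinuousLinearMap.mul ℝ ℝ) volume) =
    fun w => ∫ u, H u * k (w - u) := by
    funext w
    simp [convolution_def]
  rw [e] at h1
  rw [h1.fderiv, convolution_precompR_apply _ hH (hkc.fderiv ℝ) (hk.continuous_fderiv one_ne_zero)]
  simp [convolution_def]

lemma conv_contDiff {m : ℕ} {H k : E m → ℝ} (hH : LocallyIntegrable H volume)
    (hk : ContDiff ℝ 2 k) (hkc : HasCompactSupport k) :
    ContDiff ℝ 2 (fun w => ∫ u, H u * k (w - u)) := by
  have h1 := hkc.contDiff_convolution_right (n := 2) (ContinuousLinearMap.mul ℝ ℝ) hH hk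
  have e : (convolution H k (ContinuousLinearMap.mul ℝ ℝ) volume) =
    fun w => ∫ u, H u * k (w - u) := by
    funext w
    simp [convolution_def]
  rwa [e] at h1

lemma conv_lap {m : ℕ} {H k : E m → ℝ} (hH : LocallyIntegrable H volume)
    (hk : ContDiff ℝ 2 k) (hkc : HasCompactSupport k) (w : E m) :
    lap (fun w => ∫ u, H u * k (w - u)) w = ∑ i : Fin m, ∫ u, H u *
      fderiv ℝ (fun y => fderiv ℝ k y (EuclideanSpace.single i 1)) (w - u)
        (EuclideanSpace.single i 1) := by
  unfold lap
  refine Finset.sum_congr rfl fun i _ => ?_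
  simp_rw [conv_fderiv hH (hk.of_le one_le_two) hkc]
  refine conv_fderiv hH (k := fun y => fderiv ℝ k y (EuclideanSpace.single i 1)) ?_ ?_ w _
  · exact (hk.fderiv_right (m := 1) (by norm_num)).clm_apply contDiff_const
  · exact hkc.fderiv_apply ℝ _

lemma conv_lim {m : ℕ} {f : ℕ → E m → ℝ} {g : E m → ℝ} {S : Set (E m)} (hS : IsCompact S)
    (hfc : ∀ n, ContinuousOn (f n) S) {B : ℝ} (hB : ∀ n, ∀ x ∈ S, |f n x| ≤ B)
    (hg : ∀ x ∈ S, Tendsto (fun n => f n x) atTop (𝓝 (g x))) {k : E m → ℝ} (hk : Continuous k)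
    (hkc : HasCompactSupport k) (w : E m) :
    Tendsto (fun n => ∫ u, S.indicator (f n) u * k (w - u)) atTop
      (𝓝 (∫ u, S.indicator g u * k (w - u))) := by
  obtain ⟨C, hC⟩ := hkc.exists_bound_of_continuous hk
  have e : ∀ h : E m → ℝ, ∫ u, S.indicator h u * k (w - u) = ∫ u in S, h u * k (w - u) := by
    intro h
    rw [← integral_indicator hS.measurableSet]
    congr 1
    funext u
    by_cases hu : u ∈ S <;> simp [hu]
  simp_rw [e]
  have hfin : IsFiniteMeasure (volume.restrict S) :=
    ⟨by simpa using hS.measure_lt_top⟩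
  apply tendsto_integral_of_dominated_convergence (fun _ => B * C)
  · intro n
    exact ((hfc n).mul (by fun_prop)).aestronglyMeasurable hS.measurableSet
  · exact integrable_const _
  · intro n
    filter_upwards [ae_restrict_mem hS.measurableSet] with u hu
    rw [norm_mul]
    have h1 : ‖f n u‖ ≤ B := hB n u hu
    have h2 := hC (w - u)
    have := norm_nonneg (f n u)
    gcongr
    linarith
  · filter_upwards [ae_restrict_mem hS.measurableSet] with u hu
    exact (hg u hu).mul_const _

lemma lim_harm {m : ℕ} {U : Set (E m)} (hU : IsOpen U) {f : ℕ → E m → ℝ}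
    (hf : ∀ n, HarmOn U (f n))
    (hb : ∀ K ⊆ U, IsCompact K → ∃ B, ∀ n, ∀ x ∈ K, |f n x| ≤ B) {g : E m → ℝ}
    (hg : ∀ x ∈ U, Tendsto (fun n => f n x) atTop (𝓝 (g x))) : HarmOn U g := by
  have hgc := lim_cont hU hf hb hg
  suffices h : ∀ x ∈ U, ContDiffAt ℝ 2 g x ∧ lap g x = 0 from
    ⟨fun x hx => (h x hx).1.contDiffWithinAt, fun x hx => (h x hx).2⟩
  intro x hx
  obtain ⟨R, hR, hRU⟩ := Metric.nhds_basis_closedBall.mem_iff.1 (hU.mem_nhds hx)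
  obtain ⟨r, hr, hrR⟩ : ∃ r > 0, 3 * r = R := ⟨R / 3, by linarith, by ring⟩
  subst hrR
  set S := closedBall x (3 * r) with hS
  have hSc : IsCompact S := isCompact_closedBall _ _
  obtain ⟨B, hB⟩ := hb S hRU hSc
  set c : ℝ := r ^ m * ∫ y : E m, kr y with hc
  have hc0 : 0 < c := mul_pos (by positivity) kr_int_pos
  set k : E m → ℝ := fun v => c⁻¹ * kr (r⁻¹ • v) with hk
  have hkC : ContDiff ℝ 2 k :=
    contDiff_const.mul ((kr_contDiff (n := 2)).comp (contDiff_id.const_smul r⁻¹))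
  have hkc : HasCompactSupport k :=
    (kr_compact.comp_smul (inv_ne_zero hr.ne')).mul_left
  have hloc : ∀ h : E m → ℝ, ContinuousOn h S → LocallyIntegrable (S.indicator h) volume := by
    intro h hh
    apply Integrable.locallyIntegrable
    rw [integrable_indicator_iff hSc.measurableSet]
    exact hh.integrableOn_compact hSc
  have hfS : ∀ n, ContinuousOn (f n) S := fun n => (hf n).1.continuousOn.mono hRU
  have hrep : ∀ n, ∀ w ∈ ball x r, f n w = ∫ u, S.indicator (f n) u * k (w - u) := by
    intro n w hw
    have e : ∫ u, S.indicator (f n) u * k (w - u) =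
        c⁻¹ * ∫ u in S, f n u * kr (r⁻¹ • (w - u)) := by
      rw [← integral_indicator hSc.measurableSet, ← integral_const_mul]
      congr 1
      funext u
      by_cases hu : u ∈ S <;> simp [hu, hk]
      ring
    rw [e, loc_rep hU (hf n) hr hRU hw, ← hc]
    field_simp
  have hgS : ∀ u ∈ S, Tendsto (fun n => f n u) atTop (𝓝 (g u)) := fun u hu => hg u (hRU hu)
  have hrepg : ∀ w ∈ ball x r, g w = ∫ u, S.indicator g u * k (w - u) := by
    intro w hw
    refine tendsto_nhds_unique (hg w (hRU ?_))
      ((conv_lim hSc hfS hB hgS hkC.continuous hkc w).congr fun n => (hrep n w hw).symm)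
    simp only [mem_ball] at hw
    simp only [hS, mem_closedBall]
    linarith
  have hev : ∀ {a b : E m → ℝ}, (∀ w ∈ ball x r, a w = b w) → a =ᶠ[𝓝 x] b := by
    intro a b hab
    filter_upwards [ball_mem_nhds x hr] with w hw using hab w hw
  have hgloc := hloc g (hgc.mono hRU)
  constructor
  · exact (conv_contDiff hgloc hkC hkc).contDiffAt.congr_of_eventuallyEq (hev hrepg)
  · rw [lap_congr (hev hrepg), conv_lap hgloc hkC hkc]
    have hl : ∀ n, ∑ i : Fin m, ∫ u, S.indicator (f n) u *
      fderiv ℝ (fun y => fderiv ℝ k y (EuclideanSpace.single i 1)) (x - u)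
        (EuclideanSpace.single i 1) = 0 := by
      intro n
      rw [← conv_lap (hloc _ (hfS n)) hkC hkc, ← lap_congr (hev (hrep n))]
      exact (hf n).2 x hx
    have ht := tendsto_finsetSum (Finset.univ : Finset (Fin m)) (fun i _ =>
      conv_lim hSc hfS hB hgS
        (k := fun v => fderiv ℝ (fun y => fderiv ℝ k y (EuclideanSpace.single i 1)) v
        (EuclideanSpace.single i 1))
        ((((hkC.fderiv_right (m := 1) (by norm_num)).clm_apply contDiff_const).continuous_fderiv
          one_ne_zero).clm_apply continuous_const)
        ((hkc.fderiv_apply ℝ _).fderiv_apply ℝ _) x)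
    simp_rw [hl] at ht
    exact (tendsto_nhds_unique ht tendsto_const_nhds)

lemma SF_coe (x : ℝ) : SF (x : EReal) = Real.arctan (Real.sinh x) := by
  simp [SF]

lemma SF_lip (a b : ℝ) : |SF (a : EReal) - SF (b : EReal)| ≤ |a - b| := by
  rw [SF_coe, SF_coe]
  have h := Convex.norm_image_sub_le_of_norm_hasDerivWithin_le
    (f := fun x => Real.arctan (Real.sinh x)) (C := 1) (s := Set.univ) (x := b) (y := a)
    (fun x _ => ((Real.hasDerivAt_sinh x).arctan).hasDerivWithinAt) (by
      intro x _
      have h1 := Real.cosh_sq x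
      have h2 := Real.one_le_cosh x
      rw [Real.norm_of_nonneg (by positivity)]
      rw [div_mul_eq_mul_div, one_mul, div_le_one (by positivity)]
      nlinarith) convex_univ trivial trivial
  simpa using h

lemma SF_top : SF ⊤ = Real.pi / 2 := by simp [SF]
lemma SF_bot : SF ⊥ = -(Real.pi / 2) := by simp [SF]

lemma SF_near_top {ε : ℝ} (hε : 0 < ε) : ∃ A : ℝ, ∀ x ≥ A, |SF (x : EReal) - SF ⊤| < ε := by
  have h : Tendsto (fun x => Real.arctan (Real.sinh x)) atTop (𝓝 (Real.pi / 2)) :=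
    (Real.tendsto_arctan_atTop.mono_right nhdsWithin_le_nhds).comp
      (tendsto_atTop_mono' _ ((eventually_ge_atTop 0).mono
        fun _ hx => Real.self_le_sinh_iff.2 hx) tendsto_id)
  have := (Metric.tendsto_nhds.1 h ε hε)
  obtain ⟨A, hA⟩ := eventually_atTop.1 this
  refine ⟨A, fun x hx => ?_⟩
  rw [SF_coe, SF_top]
  exact hA x hx

lemma SF_neg (x : ℝ) : SF ((-x : ℝ) : EReal) = - SF (x : EReal) := by
  rw [SF_coe, SF_coe, Real.sinh_neg, Real.arctan_neg]

lemma SF_near_bot {ε : ℝ} (hε : 0 < ε) : ∃ A : ℝ, ∀ x ≥ A, |SF ((-x : ℝ) : EReal) - SF ⊥| < ε := by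
  obtain ⟨A, hA⟩ := SF_near_top hε
  refine ⟨A, fun x hx => ?_⟩
  have := hA x hx
  rw [SF_neg, SF_bot]
  rw [SF_top] at this
  rw [← abs_neg]
  convert this using 2
  ring

/-- **Normality criterion 2.** Fix `l : ℝ → [0,+∞]` finite at at least one point. The family
of harmonic functions `f` on `U` satisfying `|∇f| ≤ l ∘ f` is normal. -/
theorem stmt9 {m : ℕ} (U : Set (E m)) (hUo : IsOpen U) (hUc : IsConnected U)
    (l : ℝ → ENNReal) (hl : ∃ t : ℝ, l t ≠ ⊤) :
    NormalFam U {f | HarmOn U f ∧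
      ∀ x ∈ U, ENNReal.ofReal ‖gradient f x‖ ≤ l (f x)} := by
  intro f hf
  obtain ⟨t, ht⟩ := hl
  obtain ⟨p, hp⟩ := hUc.nonempty
  set M : ℝ := (l t).toReal with hM
  have hM0 : 0 ≤ M := ENNReal.toReal_nonneg
  have hF : ∀ n, Fam0 U M (fun x => f n x - t) := by
    intro n
    refine ⟨(hf n).1.sub_const' t, fun x hx h0 => ?_⟩
    have h1 := (hf n).2 x hx
    have h2 : f n x = t := by linarith
    rw [h2, ENNReal.ofReal_le_iff_le_toReal ht] at h1
    rw [fderiv_sub_const]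
    simpa [gradient] using h1
  obtain ⟨a, φ, hφ, hlim⟩ := CompactSpace.tendsto_subseq
    (fun n => ((f n p - t : ℝ) : EReal))
  induction a using EReal.rec with
  | bot =>
    refine ⟨φ, hφ, Or.inr (Or.inr ?_)⟩
    have hlim' : Tendsto (fun n => -(f (φ n) p - t)) atTop atTop := by
      rw [Function.comp_def, EReal.tendsto_coe_nhds_bot_iff] at hlim
      exact tendsto_neg_atBot_atTop.comp hlim
    intro K hKU hK ε hε
    obtain ⟨A, hA⟩ := SF_near_bot hε
    obtain ⟨N, hN⟩ := eventually_atTop.1 (glob_top hUo hUc.isPreconnected hM0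
      (f := fun n x => -(f (φ n) x - t)) (fun n => (hF (φ n)).neg) hp hlim' hK hKU (A + t))
    refine ⟨N, fun n hn x hx => ?_⟩
    have := hA (-(f (φ n) x)) (by linarith [hN n hn x hx])
    simpa using this
  | coe a =>
    have hlim' : Tendsto (fun n => f (φ n) p - t) atTop (𝓝 a) := by
      rw [Function.comp_def, EReal.tendsto_coe] at hlim
      exact hlim
    obtain ⟨B, hB⟩ := (Metric.isBounded_range_of_tendsto _ hlim').exists_norm_le
    have hbd : ∀ K ⊆ U, IsCompact K → ∃ B, ∀ n, ∀ x ∈ K, |f (φ n) x - t| ≤ B :=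
      fun K hKU hK => glob_bdd hUo hUc.isPreconnected hM0
        (f := fun n x => f (φ n) x - t) (fun n => hF (φ n)) hp
        ⟨B, fun n => hB _ ⟨n, rfl⟩⟩ hK hKU
    obtain ⟨ψ, hψ, g, hg⟩ := subseq_pt hUo (f := fun n x => f (φ n) x - t)
      (fun n => (hF (φ n)).1) hbd
    refine ⟨φ ∘ ψ, hφ.comp hψ, Or.inl ⟨fun x => g x - (-t), ?_, ?_⟩⟩
    · refine HarmOn.sub_const' ?_ _
      exact lim_harm hUo (f := fun n x => f (φ (ψ n)) x - t) (fun n => (hF (φ (ψ n))).1)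
        (fun K hKU hK => (hbd K hKU hK).imp fun B hB n => hB (ψ n)) hg
    · intro K hKU hK ε hε
      obtain ⟨N, hN⟩ := eventually_atTop.1 (lim_unif hUo (f := fun n x => f (φ (ψ n)) x - t)
        (fun n => (hF (φ (ψ n))).1)
        (fun K hKU hK => (hbd K hKU hK).imp fun B hB n => hB (ψ n)) hg hK hKU hε)
      refine ⟨N, fun n hn x hx => (SF_lip _ _).trans_lt ?_⟩
      have := hN n hn x hx
      have e : f (φ (ψ n)) x - (g x - -t) = f (φ (ψ n)) x - t - g x := by ring
      simp only [Function.comp]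
      rw [e]
      exact this
  | top =>
    refine ⟨φ, hφ, Or.inr (Or.inl ?_)⟩
    have hlim' : Tendsto (fun n => (f (φ n) p - t)) atTop atTop := by
      rwa [Function.comp_def, EReal.tendsto_coe_nhds_top_iff] at hlim
    intro K hKU hK ε hε
    obtain ⟨A, hA⟩ := SF_near_top hε
    obtain ⟨N, hN⟩ := eventually_atTop.1 (glob_top hUo hUc.isPreconnected hM0
      (f := fun n x => (f (φ n) x - t)) (fun n => (hF (φ n))) hp hlim' hK hKU (A - t))
    refine ⟨N, fun n hn x hx => ?_⟩
    exact hA (f (φ n) x) (by linarith [hN n hn x hx])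

end
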